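/- arXiv:1604.04204 — 2 statements merged into one kernel-verified Lean document; each statement's English description precedes it below -/
import Mathlib

section
/- Let x ≥ y ≥ 2 be real and let n > 1 be an integer. Then the function φ_n(β) := log Z_n(β) on [0,∞) satisfies: (i) φ_n''(β) > 0 for all β ≥ 0; (ii) φ_n''(0) = m_{2,n}; (iii) for every κ > 0 there exists a constant c(κ) > 0 (independent of x, y, n) such that if ω̃_{x,y}(n) ≥ κ·ū and n ∈ S(x,y), then φ_n''(ū/log x) ≥ c(κ)·(log x)²/ū; (iv) there is an absolute constant C > 0 such that 0 ≤ −φ_n'''(β) ≤ C·β·m_{4,n} for all β ≥ 0. -/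
open Finset MeasureTheory
open scoped Classical

noncomputable section

/-- The set of primes `p ≤ y`. -/
def primesUpTo (y : ℝ) : Finset ℕ := (Finset.range (⌊y⌋₊ + 1)).filter Nat.Prime

/-- `S(x,y)`: the set of `y`-friable integers in `[1,x]`. -/
def Sf (x y : ℝ) : Finset ℕ :=
  (Finset.Icc 1 ⌊x⌋₊).filter fun n => ∀ p : ℕ, p.Prime → p ∣ n → (p : ℝ) ≤ y

/-- `Ψ(x,y)`. -/
def Psi (x y : ℝ) : ℝ := (Sf x y).card

/-- `u = log x / log y`. -/
def uQ (x y : ℝ) : ℝ := Real.log x / Real.log y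

/-- `ū = min(u, π(y))`. -/
def ubar (x y : ℝ) : ℝ := min (uQ x y) ((primesUpTo y).card)

/-- `ν_{x,y}(A) = |A ∩ S(x,y)| / Ψ(x,y)`. -/
def nuMeas (x y : ℝ) (A : Set ℕ) : ℝ :=
  (((Sf x y).filter fun n => n ∈ A).card : ℝ) / Psi x y

/-- `P(D_n ≥ t) = #{d ∣ n : log d ≥ t} / τ(n)`. -/
def DnProb (n : ℕ) (t : ℝ) : ℝ :=
  ((n.divisors.filter fun d => t ≤ Real.log d).card : ℝ) / (n.divisors.card : ℝ)

/-- `m_{2,n}`. -/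
def m2 (n : ℕ) : ℝ :=
  (1 / 12) * ∑ p ∈ n.primeFactors,
    (n.factorization p : ℝ) * ((n.factorization p : ℝ) + 2) * Real.log p ^ 2

/-- `m_{4,n}`. -/
def m4 (n : ℕ) : ℝ :=
  (1 / 240) * ∑ p ∈ n.primeFactors,
    (n.factorization p : ℝ) * ((n.factorization p : ℝ) + 2) *
      (3 * (n.factorization p : ℝ) ^ 2 + 6 * (n.factorization p : ℝ) - 4) * Real.log p ^ 4

/-- `σ_n = √(m_{2,n})`. -/
def sigman (n : ℕ) : ℝ := Real.sqrt (m2 n)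

/-- `w_n = m_{2,n}² / m_{4,n}`, with `w_1 = 1`. -/
def wn (n : ℕ) : ℝ := if n = 1 then 1 else m2 n ^ 2 / m4 n

/-- `Φ(z) = (1/√(2π)) ∫_z^∞ e^{-t²/2} dt`. -/
def GaussPhi (z : ℝ) : ℝ :=
  (1 / Real.sqrt (2 * Real.pi)) * ∫ t in Set.Ioi z, Real.exp (-t ^ 2 / 2)

/-- `ω̃_{x,y}(n)`. -/
def omegaTilde (x y : ℝ) (n : ℕ) : ℕ :=
  ((n.primeFactors).filter fun p : ℕ =>
    Real.sqrt y < (p : ℝ) ∧ (p : ℝ) ≤ y ∧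
      uQ x y / (2 * ubar x y) ≤ (n.factorization p : ℝ) ∧
      (n.factorization p : ℝ) ≤ 2 * uQ x y / ubar x y).card

/-- The saddle-point equation defining `α(x,y)`. -/
def saddleEq (x y α : ℝ) : Prop :=
  ∑ p ∈ primesUpTo y, Real.log p / ((p : ℝ) ^ α - 1) = Real.log x

/-- `σ̄(x,y)` (in terms of `y` and `α`). -/
def sigmaBar (y α : ℝ) : ℝ :=
  Real.sqrt ((1 / 2) * ∑ p ∈ primesUpTo y,
    ((p : ℝ) ^ α - 1 / 3) * Real.log p ^ 2 / ((p : ℝ) ^ α - 1) ^ 2)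

/-- `ζ(α,y)`. -/
def zetaY (y α : ℝ) : ℝ := ∏ p ∈ primesUpTo y, (1 - (p : ℝ) ^ (-α))⁻¹

/-- `f_k(n) = ∑_{p^ν ‖ n} (ν log p)^k`. -/
def fk (k : ℕ) (n : ℕ) : ℝ :=
  ∑ p ∈ n.primeFactors, ((n.factorization p : ℝ) * Real.log p) ^ k

/-- `A_f(x,y) = ∑_{p ≤ y} ∑_{ν ≥ 1} f(p^ν) p^{-να} (1 - p^{-α})`. -/
def Af (y α : ℝ) (f : ℕ → ℝ) : ℝ :=
  ∑ p ∈ primesUpTo y, ∑' ν : ℕ,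
    f (p ^ (ν + 1)) * (p : ℝ) ^ (-(((ν : ℝ) + 1) * α)) * (1 - (p : ℝ) ^ (-α))

/-- `Z_n(β)` for real `β` (each Euler factor written as the everywhere-defined mean
`(1/(ν+1)) ∑_{0 ≤ j ≤ ν} p^{jβ}`, which is the continuous extension of
`(p^{(ν+1)β}-1)/((ν+1)(p^β-1))`). -/
def ZnR (n : ℕ) (β : ℝ) : ℝ :=
  ∏ p ∈ n.primeFactors,
    (∑ j ∈ Finset.range (n.factorization p + 1), (p : ℝ) ^ ((j : ℝ) * β)) /
      ((n.factorization p : ℝ) + 1)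

/-- `φ_n = log Z_n` on the reals. -/
def phiN (n : ℕ) (β : ℝ) : ℝ := Real.log (ZnR n β)

/-- `Z_n(s)` for complex `s`. -/
def ZnC (n : ℕ) (s : ℂ) : ℂ :=
  ∏ p ∈ n.primeFactors,
    (∑ j ∈ Finset.range (n.factorization p + 1), (p : ℂ) ^ ((j : ℂ) * s)) /
      ((n.factorization p : ℂ) + 1)

/-- Distance from `θ` to the nearest integer. -/
def nid (θ : ℝ) : ℝ := |θ - round θ|

/-- `V_y(s) = (y^{1-s} - 1)/(1 - s)`, extended by continuity at `s = 1`. -/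
def Vy (y : ℝ) (s : ℂ) : ℂ :=
  if s = 1 then (Real.log y : ℂ) else (((y : ℝ) : ℂ) ^ (1 - s) - 1) / (1 - s)

/-- The weighted power sum `∑_{0 ≤ j ≤ ν} j^k e^{jt}`. -/
def expPowSum (ν k : ℕ) (t : ℝ) : ℝ :=
  ∑ j ∈ Finset.range (ν + 1), (j : ℝ) ^ k * Real.exp (j * t)

/-- First derivative of `log ∑_{0 ≤ j ≤ ν} e^{jt}`. -/
def cumulant1 (ν : ℕ) (t : ℝ) : ℝ := expPowSum ν 1 t / expPowSum ν 0 t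

/-- Second derivative of `log ∑_{0 ≤ j ≤ ν} e^{jt}`. -/
def cumulant2 (ν : ℕ) (t : ℝ) : ℝ :=
  (expPowSum ν 2 t * expPowSum ν 0 t - expPowSum ν 1 t ^ 2) / expPowSum ν 0 t ^ 2

/-- Third derivative of `log ∑_{0 ≤ j ≤ ν} e^{jt}`. -/
def cumulant3 (ν : ℕ) (t : ℝ) : ℝ :=
  (expPowSum ν 3 t * expPowSum ν 0 t ^ 2
    - 3 * expPowSum ν 2 t * expPowSum ν 1 t * expPowSum ν 0 t
    + 2 * expPowSum ν 1 t ^ 3) / expPowSum ν 0 t ^ 3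

/-- Fourth derivative of `log ∑_{0 ≤ j ≤ ν} e^{jt}`. -/
def cumulant4 (ν : ℕ) (t : ℝ) : ℝ :=
  (expPowSum ν 4 t * expPowSum ν 0 t ^ 3
    - 4 * expPowSum ν 3 t * expPowSum ν 1 t * expPowSum ν 0 t ^ 2
    - 3 * expPowSum ν 2 t ^ 2 * expPowSum ν 0 t ^ 2
    + 12 * expPowSum ν 2 t * expPowSum ν 1 t ^ 2 * expPowSum ν 0 t
    - 6 * expPowSum ν 1 t ^ 4) / expPowSum ν 0 t ^ 4

lemma expPowSum_zero_pos (ν : ℕ) (t : ℝ) : 0 < expPowSum ν 0 t := by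
  unfold expPowSum
  refine Finset.sum_pos (fun j _ => ?_) ⟨0, by simp⟩
  positivity

lemma expPowSum_nonneg (ν k : ℕ) (t : ℝ) : 0 ≤ expPowSum ν k t := by
  unfold expPowSum
  exact Finset.sum_nonneg fun j _ => by positivity

lemma expPowSum_le (ν k : ℕ) (t : ℝ) : expPowSum ν k t ≤ (ν : ℝ) ^ k * expPowSum ν 0 t := by
  unfold expPowSum
  rw [Finset.mul_sum]
  refine Finset.sum_le_sum fun j hj => ?_
  have hj' : (j : ℝ) ≤ ν := by
    exact_mod_cast Nat.lt_succ_iff.mp (Finset.mem_range.mp hj)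
  rw [pow_zero, one_mul]
  gcongr

lemma expPowSum_zero_le (ν : ℕ) {t : ℝ} (ht : 0 ≤ t) :
    expPowSum ν 0 t ≤ ((ν : ℝ) + 1) * Real.exp (ν * t) := by
  unfold expPowSum
  have h : ∀ j ∈ Finset.range (ν + 1), (j : ℝ) ^ 0 * Real.exp (j * t) ≤ Real.exp (ν * t) := by
    intro j hj
    have hj' : (j : ℝ) ≤ ν := by
      exact_mod_cast Nat.lt_succ_iff.mp (Finset.mem_range.mp hj)
    rw [pow_zero, one_mul]
    gcongr
  simpa using Finset.sum_le_card_nsmul _ _ _ h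

lemma hasDerivAt_expPowSum (ν k : ℕ) (t : ℝ) :
    HasDerivAt (expPowSum ν k) (expPowSum ν (k + 1) t) t := by
  unfold expPowSum
  refine HasDerivAt.fun_sum fun j _ => ?_
  have h := (((hasDerivAt_id t).const_mul (j : ℝ)).exp).const_mul ((j : ℝ) ^ k)
  refine h.congr_deriv ?_
  simp only [id_eq]
  ring

lemma hasDerivAt_log_expPowSum (ν : ℕ) (t : ℝ) :
    HasDerivAt (fun t => Real.log (expPowSum ν 0 t)) (cumulant1 ν t) t :=
  (hasDerivAt_expPowSum ν 0 t).log (expPowSum_zero_pos ν t).ne'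

lemma hasDerivAt_cumulant1 (ν : ℕ) (t : ℝ) :
    HasDerivAt (cumulant1 ν) (cumulant2 ν t) t := by
  have h0 := (expPowSum_zero_pos ν t).ne'
  have h := (hasDerivAt_expPowSum ν 1 t).div (hasDerivAt_expPowSum ν 0 t) h0
  refine h.congr_deriv ?_
  simp only [cumulant2]
  field_simp

lemma hasDerivAt_cumulant2 (ν : ℕ) (t : ℝ) :
    HasDerivAt (cumulant2 ν) (cumulant3 ν t) t := by
  have h0 := (expPowSum_zero_pos ν t).ne'
  have d0 := hasDerivAt_expPowSum ν 0 t
  have d1 := hasDerivAt_expPowSum ν 1 t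
  have d2 := hasDerivAt_expPowSum ν 2 t
  have h := ((d2.mul d0).sub (d1.pow 2)).div (d0.pow 2) (pow_ne_zero 2 h0)
  refine h.congr_deriv ?_
  simp [cumulant3]
  field_simp
  ring

lemma hasDerivAt_cumulant3 (ν : ℕ) (t : ℝ) :
    HasDerivAt (cumulant3 ν) (cumulant4 ν t) t := by
  have h0 := (expPowSum_zero_pos ν t).ne'
  have d0 := hasDerivAt_expPowSum ν 0 t
  have d1 := hasDerivAt_expPowSum ν 1 t
  have d2 := hasDerivAt_expPowSum ν 2 t
  have d3 := hasDerivAt_expPowSum ν 3 t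
  have h := (((d3.mul (d0.pow 2)).sub (((d2.const_mul 3).mul d1).mul d0)).add
    ((d1.pow 3).const_mul 2)).div (d0.pow 3) (pow_ne_zero 3 h0)
  refine h.congr_deriv ?_
  simp [cumulant4]
  field_simp
  ring

lemma expPowSum_zero_zero (ν : ℕ) : expPowSum ν 0 0 = (ν : ℝ) + 1 := by
  simp [expPowSum]

lemma expPowSum_one_zero (ν : ℕ) : expPowSum ν 1 0 = (ν : ℝ) * (ν + 1) / 2 := by
  simp only [expPowSum, mul_zero, Real.exp_zero, mul_one]
  induction ν with
  | zero => simp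
  | succ n ih => rw [Finset.sum_range_succ, ih]; push_cast; ring

lemma expPowSum_two_zero (ν : ℕ) :
    expPowSum ν 2 0 = (ν : ℝ) * (ν + 1) * (2 * ν + 1) / 6 := by
  simp only [expPowSum, mul_zero, Real.exp_zero, mul_one]
  induction ν with
  | zero => simp
  | succ n ih => rw [Finset.sum_range_succ, ih]; push_cast; ring

lemma expPowSum_three_zero (ν : ℕ) :
    expPowSum ν 3 0 = ((ν : ℝ) * (ν + 1) / 2) ^ 2 := by
  simp only [expPowSum, mul_zero, Real.exp_zero, mul_one]
  induction ν with
  | zero => simp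
  | succ n ih => rw [Finset.sum_range_succ, ih]; push_cast; ring

lemma cumulant2_zero (ν : ℕ) : cumulant2 ν 0 = (ν : ℝ) * (ν + 2) / 12 := by
  rw [cumulant2, expPowSum_zero_zero, expPowSum_one_zero, expPowSum_two_zero]
  have : (ν : ℝ) + 1 ≠ 0 := by positivity
  field_simp
  ring

lemma cumulant3_zero (ν : ℕ) : cumulant3 ν 0 = 0 := by
  rw [cumulant3, expPowSum_zero_zero, expPowSum_one_zero, expPowSum_two_zero,
    expPowSum_three_zero]
  have : (ν : ℝ) + 1 ≠ 0 := by positivity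
  field_simp
  ring

lemma expPowSum_variance (ν : ℕ) (t : ℝ) :
    2 * (expPowSum ν 2 t * expPowSum ν 0 t - expPowSum ν 1 t ^ 2) =
      ∑ i ∈ Finset.range (ν + 1), ∑ j ∈ Finset.range (ν + 1),
        ((i : ℝ) - j) ^ 2 * Real.exp ((i + j) * t) := by
  have h : ∀ i j : ℕ, ((i : ℝ) - j) ^ 2 * Real.exp ((i + j) * t) =
      ((i : ℝ) ^ 2 * Real.exp (i * t)) * ((j : ℝ) ^ 0 * Real.exp (j * t))
      - 2 * (((i : ℝ) ^ 1 * Real.exp (i * t)) * ((j : ℝ) ^ 1 * Real.exp (j * t)))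
      + ((i : ℝ) ^ 0 * Real.exp (i * t)) * ((j : ℝ) ^ 2 * Real.exp (j * t)) := by
    intro i j
    rw [add_mul, Real.exp_add]
    ring
  simp only [h, Finset.sum_add_distrib, Finset.sum_sub_distrib, ← Finset.mul_sum,
    ← Finset.sum_mul, expPowSum]
  ring

lemma expPowSum_variance_ge (ν : ℕ) {t : ℝ} (ht : 0 ≤ t) :
    ((ν : ℝ) + 1) ^ 2 * (ν * (ν + 2) / 12) ≤
      expPowSum ν 2 t * expPowSum ν 0 t - expPowSum ν 1 t ^ 2 := by
  have h : expPowSum ν 2 0 * expPowSum ν 0 0 - expPowSum ν 1 0 ^ 2 ≤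
      expPowSum ν 2 t * expPowSum ν 0 t - expPowSum ν 1 t ^ 2 := by
    refine le_of_mul_le_mul_left ?_ (zero_lt_two' ℝ)
    rw [expPowSum_variance, expPowSum_variance]
    refine Finset.sum_le_sum fun i _ => Finset.sum_le_sum fun j _ => ?_
    gcongr
  rw [expPowSum_zero_zero, expPowSum_one_zero, expPowSum_two_zero] at h
  linarith

lemma cumulant2_ge (ν : ℕ) {t : ℝ} (ht : 0 ≤ t) :
    Real.exp (-(2 * (ν * t))) * (ν * (ν + 2) / 12) ≤ cumulant2 ν t := by
  have h0 := expPowSum_zero_pos ν t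
  have h1 : expPowSum ν 0 t ^ 2 ≤ (((ν : ℝ) + 1) * Real.exp (ν * t)) ^ 2 := by
    gcongr
    exact expPowSum_zero_le ν ht
  rw [cumulant2, le_div_iff₀ (by positivity)]
  refine le_trans ?_ (expPowSum_variance_ge ν ht)
  calc Real.exp (-(2 * (ν * t))) * ((ν : ℝ) * (ν + 2) / 12) * expPowSum ν 0 t ^ 2
      ≤ Real.exp (-(2 * (ν * t))) * ((ν : ℝ) * (ν + 2) / 12) *
          (((ν : ℝ) + 1) * Real.exp (ν * t)) ^ 2 := by gcongr
    _ = (Real.exp (-(2 * (ν * t))) * Real.exp (2 * (ν * t))) *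
          (((ν : ℝ) + 1) ^ 2 * (ν * (ν + 2) / 12)) := by
        rw [two_mul, Real.exp_add]; ring
    _ = ((ν : ℝ) + 1) ^ 2 * (ν * (ν + 2) / 12) := by
        rw [← Real.exp_add, neg_add_cancel, Real.exp_zero, one_mul]

lemma cumulant2_pos {ν : ℕ} (hν : 0 < ν) {t : ℝ} (ht : 0 ≤ t) : 0 < cumulant2 ν t :=
  lt_of_lt_of_le (by positivity) (cumulant2_ge ν ht)

lemma cumulant4_ge (ν : ℕ) (t : ℝ) : -(13 * (ν : ℝ) ^ 4) ≤ cumulant4 ν t := by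
  have h0 := expPowSum_zero_pos ν t
  rw [cumulant4, le_div_iff₀ (by positivity)]
  have n1 := expPowSum_nonneg ν 1 t
  have n2 := expPowSum_nonneg ν 2 t
  have n3 := expPowSum_nonneg ν 3 t
  have n4 := expPowSum_nonneg ν 4 t
  have l1 := expPowSum_le ν 1 t
  have l2 := expPowSum_le ν 2 t
  have l3 := expPowSum_le ν 3 t
  set a := expPowSum ν 0 t
  set b := expPowSum ν 1 t
  set c := expPowSum ν 2 t
  set d := expPowSum ν 3 t
  have e1 : d * b * a ^ 2 ≤ ((ν : ℝ) ^ 3 * a) * ((ν : ℝ) ^ 1 * a) * a ^ 2 := by gcongr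
  have e2 : c ^ 2 * a ^ 2 ≤ ((ν : ℝ) ^ 2 * a) ^ 2 * a ^ 2 := by gcongr
  have e3 : b ^ 4 ≤ ((ν : ℝ) ^ 1 * a) ^ 4 := by gcongr
  have p1 : 0 ≤ expPowSum ν 4 t * a ^ 3 := by positivity
  have p2 : 0 ≤ c * b ^ 2 * a := by positivity
  linarith

lemma nonneg_of_hasDerivAt_nonneg {f f' : ℝ → ℝ} (hf : ∀ t, HasDerivAt f (f' t) t)
    (h' : ∀ t, 0 < t → 0 ≤ f' t) (h0 : f 0 = 0) {t : ℝ} (ht : 0 ≤ t) : 0 ≤ f t := by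
  have hm : MonotoneOn f (Set.Ici 0) := by
    refine monotoneOn_of_deriv_nonneg (convex_Ici 0)
      (fun s _ => (hf s).continuousAt.continuousWithinAt)
      (fun s _ => (hf s).differentiableAt.differentiableWithinAt) fun s hs => ?_
    rw [(hf s).deriv]
    rw [interior_Ici] at hs
    exact h' s hs
  rw [← h0]
  exact hm Set.self_mem_Ici ht ht

lemma neg_cumulant3_le (ν : ℕ) {t : ℝ} (ht : 0 ≤ t) :
    -cumulant3 ν t ≤ 13 * (ν : ℝ) ^ 4 * t := by
  have h := nonneg_of_hasDerivAt_nonneg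
    (f := fun t => cumulant3 ν t + 13 * (ν : ℝ) ^ 4 * t)
    (f' := fun t => cumulant4 ν t + 13 * (ν : ℝ) ^ 4 * 1)
    (fun s => (hasDerivAt_cumulant3 ν s).add ((hasDerivAt_id s).const_mul _))
    (fun s _ => by linarith [cumulant4_ge ν s]) (by simp [cumulant3_zero]) ht
  linarith

lemma three_mul_sinh_le {t : ℝ} (ht : 0 ≤ t) :
    3 * Real.sinh t ≤ t * (Real.cosh t + 2) := by
  have h1 : ∀ s : ℝ, 0 ≤ s → 0 ≤ s * Real.cosh s - Real.sinh s := fun s hs =>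
    nonneg_of_hasDerivAt_nonneg (f := fun s => s * Real.cosh s - Real.sinh s)
      (f' := fun s => s * Real.sinh s)
      (fun r => by
        have h := ((hasDerivAt_id r).mul (Real.hasDerivAt_cosh r)).sub
          (Real.hasDerivAt_sinh r)
        refine h.congr_deriv ?_
        simp)
      (fun r hr => mul_nonneg hr.le (Real.sinh_nonneg_iff.mpr hr.le)) (by simp) hs
  have h2 : ∀ s : ℝ, 0 ≤ s → 0 ≤ s * Real.sinh s + 2 - 2 * Real.cosh s := fun s hs =>
    nonneg_of_hasDerivAt_nonneg (f := fun s => s * Real.sinh s + 2 - 2 * Real.cosh s)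
      (f' := fun s => s * Real.cosh s - Real.sinh s)
      (fun r => by
        have h := (((hasDerivAt_id r).mul (Real.hasDerivAt_sinh r)).add_const 2).sub
          ((Real.hasDerivAt_cosh r).const_mul 2)
        refine h.congr_deriv ?_
        simp only [id_eq]
        ring)
      (fun r hr => h1 r hr.le) (by simp) hs
  have h3 := nonneg_of_hasDerivAt_nonneg
      (f := fun s => s * (Real.cosh s + 2) - 3 * Real.sinh s)
      (f' := fun s => s * Real.sinh s + 2 - 2 * Real.cosh s)
      (fun r => by
        have h := ((hasDerivAt_id r).mul ((Real.hasDerivAt_cosh r).add_const 2)).sub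
          ((Real.hasDerivAt_sinh r).const_mul 3)
        refine h.congr_deriv ?_
        simp only [id_eq]
        ring)
      (fun r hr => h2 r hr.le) (by simp) ht
  linarith

lemma three_mul_exp_sq_sub_one_le {t : ℝ} (ht : 0 ≤ t) :
    3 * (Real.exp t ^ 2 - 1) ≤ t * (Real.exp t ^ 2 + 4 * Real.exp t + 1) := by
  have h := mul_le_mul_of_nonneg_left (three_mul_sinh_le ht)
    (by positivity : 0 ≤ 2 * Real.exp t)
  rw [Real.sinh_eq, Real.cosh_eq] at h
  have he : Real.exp t * Real.exp (-t) = 1 := by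
    rw [← Real.exp_add, add_neg_cancel, Real.exp_zero]
  linear_combination h + (3 + t) * he

lemma exp_sub_one_pos {t : ℝ} (ht : 0 < t) : 0 < Real.exp t - 1 :=
  sub_pos.mpr (Real.one_lt_exp_iff.mpr ht)

/-- Third derivative of `log (e^t - 1)`. -/
def logExpSubOne3 (t : ℝ) : ℝ :=
  Real.exp t * (Real.exp t + 1) / (Real.exp t - 1) ^ 3

lemma hasDerivAt_log_exp_sub_one {t : ℝ} (ht : 0 < t) :
    HasDerivAt (fun t => Real.log (Real.exp t - 1)) (Real.exp t / (Real.exp t - 1)) t :=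
  ((Real.hasDerivAt_exp t).sub_const 1).log (exp_sub_one_pos ht).ne'

lemma hasDerivAt_exp_div_exp_sub_one {t : ℝ} (ht : 0 < t) :
    HasDerivAt (fun t => Real.exp t / (Real.exp t - 1))
      (-Real.exp t / (Real.exp t - 1) ^ 2) t := by
  have h := (Real.hasDerivAt_exp t).div ((Real.hasDerivAt_exp t).sub_const 1)
    (exp_sub_one_pos ht).ne'
  refine h.congr_deriv ?_
  ring

lemma hasDerivAt_neg_exp_div_exp_sub_one_sq {t : ℝ} (ht : 0 < t) :
    HasDerivAt (fun t => -Real.exp t / (Real.exp t - 1) ^ 2) (logExpSubOne3 t) t := by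
  have h0 := (exp_sub_one_pos ht).ne'
  have h := (Real.hasDerivAt_exp t).neg.div (((Real.hasDerivAt_exp t).sub_const 1).pow 2)
    (pow_ne_zero 2 h0)
  refine h.congr_deriv ?_
  simp [logExpSubOne3]
  field_simp
  ring

lemma antitoneOn_cube_mul_logExpSubOne3 :
    AntitoneOn (fun t => t ^ 3 * logExpSubOne3 t) (Set.Ioi 0) := by
  have hd : ∀ t : ℝ, 0 < t → HasDerivAt (fun t => t ^ 3 * logExpSubOne3 t)
      (t ^ 2 * Real.exp t * (3 * (Real.exp t ^ 2 - 1)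
        - t * (Real.exp t ^ 2 + 4 * Real.exp t + 1)) / (Real.exp t - 1) ^ 4) t := by
    intro t ht
    have h0 := (exp_sub_one_pos ht).ne'
    have he := Real.hasDerivAt_exp t
    have h := ((hasDerivAt_id t).pow 3).mul ((he.mul (he.add_const 1)).div
      ((he.sub_const 1).pow 3) (pow_ne_zero 3 h0))
    refine h.congr_deriv ?_
    simp
    field_simp
    ring
  refine antitoneOn_of_deriv_nonpos (convex_Ioi 0)
    (fun s hs => (hd s hs).continuousAt.continuousWithinAt)
    (fun s hs => ?_) fun s hs => ?_
  · rw [interior_Ioi] at hs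
    exact (hd s hs).differentiableAt.differentiableWithinAt
  · rw [interior_Ioi] at hs
    have hs' : 0 < s := hs
    rw [(hd s hs).deriv]
    have h1 := three_mul_exp_sq_sub_one_le hs'.le
    have h2 := exp_sub_one_pos hs'
    refine div_nonpos_of_nonpos_of_nonneg ?_ (by positivity)
    exact mul_nonpos_of_nonneg_of_nonpos (by positivity) (by linarith)

lemma eqOn_Ioi_of_hasDerivAt {f g f' g' : ℝ → ℝ} (hfg : Set.EqOn f g (Set.Ioi 0))
    (hf : ∀ t, 0 < t → HasDerivAt f (f' t) t) (hg : ∀ t, 0 < t → HasDerivAt g (g' t) t) :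
    Set.EqOn f' g' (Set.Ioi 0) := fun t ht =>
  (hf t ht).unique ((hg t ht).congr_of_eventuallyEq
    (hfg.eventuallyEq_of_mem (Ioi_mem_nhds ht)))

lemma log_expPowSum_zero_eq (ν : ℕ) {t : ℝ} (ht : 0 < t) :
    Real.log (expPowSum ν 0 t) =
      Real.log (Real.exp (((ν : ℝ) + 1) * t) - 1) - Real.log (Real.exp t - 1) := by
  have h1 := exp_sub_one_pos ht
  have h2 : expPowSum ν 0 t * (Real.exp t - 1) = Real.exp (((ν : ℝ) + 1) * t) - 1 := by
    have h := geom_sum_mul (Real.exp t) (ν + 1)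
    simp only [← Real.exp_nat_mul] at h
    simpa [expPowSum] using h
  rw [← h2, Real.log_mul (expPowSum_zero_pos ν t).ne' h1.ne', add_sub_cancel_right]

lemma cumulant3_eq (ν : ℕ) {t : ℝ} (ht : 0 < t) :
    cumulant3 ν t =
      ((ν : ℝ) + 1) ^ 3 * logExpSubOne3 (((ν : ℝ) + 1) * t) - logExpSubOne3 t := by
  set N : ℝ := (ν : ℝ) + 1 with hN
  have hN0 : 0 < N := by positivity
  have hlin : ∀ s : ℝ, HasDerivAt (fun s => N * s) N s := fun s => by
    simpa using (hasDerivAt_id s).const_mul N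
  have e0 : Set.EqOn (fun t => Real.log (expPowSum ν 0 t))
      (fun t => Real.log (Real.exp (N * t) - 1) - Real.log (Real.exp t - 1)) (Set.Ioi 0) :=
    fun s hs => log_expPowSum_zero_eq ν hs
  have e1 := eqOn_Ioi_of_hasDerivAt e0 (fun s _ => hasDerivAt_log_expPowSum ν s)
    (fun s hs => ((hasDerivAt_log_exp_sub_one (mul_pos hN0 hs)).comp s (hlin s)).sub
      (hasDerivAt_log_exp_sub_one hs))
  have e2 := eqOn_Ioi_of_hasDerivAt e1 (fun s _ => hasDerivAt_cumulant1 ν s)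
    (fun s hs => (((hasDerivAt_exp_div_exp_sub_one (mul_pos hN0 hs)).comp s
      (hlin s)).mul_const N).sub (hasDerivAt_exp_div_exp_sub_one hs))
  have e3 := eqOn_Ioi_of_hasDerivAt e2 (fun s _ => hasDerivAt_cumulant2 ν s)
    (fun s hs => ((((hasDerivAt_neg_exp_div_exp_sub_one_sq (mul_pos hN0 hs)).comp s
      (hlin s)).mul_const N).mul_const N).sub (hasDerivAt_neg_exp_div_exp_sub_one_sq hs))
  rw [e3 ht]
  ring

lemma cumulant3_nonpos (ν : ℕ) {t : ℝ} (ht : 0 ≤ t) : cumulant3 ν t ≤ 0 := by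
  rcases ht.eq_or_lt with rfl | ht
  · exact (cumulant3_zero ν).le
  have hle : t ≤ ((ν : ℝ) + 1) * t := by nlinarith [Nat.cast_nonneg (α := ℝ) ν]
  have h := antitoneOn_cube_mul_logExpSubOne3 (Set.mem_Ioi.mpr ht)
    (Set.mem_Ioi.mpr (ht.trans_le hle)) hle
  rw [cumulant3_eq ν ht, sub_nonpos]
  refine le_of_mul_le_mul_left ?_ (pow_pos ht 3)
  linarith

lemma phiN_eq (n : ℕ) (β : ℝ) :
    phiN n β = ∑ p ∈ n.primeFactors,
      (Real.log (expPowSum (n.factorization p) 0 (Real.log p * β))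
        - Real.log ((n.factorization p : ℝ) + 1)) := by
  have h : ∀ p ∈ n.primeFactors,
      (∑ j ∈ Finset.range (n.factorization p + 1), (p : ℝ) ^ ((j : ℝ) * β)) =
        expPowSum (n.factorization p) 0 (Real.log p * β) := by
    intro p hp
    have hp0 : (0 : ℝ) < p := by exact_mod_cast (Nat.prime_of_mem_primeFactors hp).pos
    refine Finset.sum_congr rfl fun j _ => ?_
    rw [Real.rpow_def_of_pos hp0, pow_zero, one_mul]
    congr 1
    ring
  rw [phiN, ZnR, Finset.prod_congr rfl fun p hp => by rw [h p hp], Real.log_prod]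
  · refine Finset.sum_congr rfl fun p _ => ?_
    exact Real.log_div (expPowSum_zero_pos _ _).ne' (by positivity)
  · intro p _
    have := expPowSum_zero_pos (n.factorization p) (Real.log p * β)
    positivity

lemma hasDerivAt_sum_comp_log_mul (n : ℕ) (a : ℕ → ℝ) {f f' : ℕ → ℝ → ℝ}
    (hf : ∀ ν t, HasDerivAt (f ν) (f' ν t) t) (β : ℝ) :
    HasDerivAt (fun β => ∑ p ∈ n.primeFactors, a p * f (n.factorization p) (Real.log p * β))
      (∑ p ∈ n.primeFactors, a p * Real.log p * f' (n.factorization p) (Real.log p * β)) β := by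
  refine HasDerivAt.fun_sum fun p _ => ?_
  have hlin : HasDerivAt (fun s : ℝ => Real.log p * s) (Real.log p) β := by
    simpa using (hasDerivAt_id β).const_mul (Real.log (p : ℝ))
  have h := ((hf (n.factorization p) (Real.log p * β)).comp β hlin).const_mul (a p)
  refine h.congr_deriv ?_
  ring

lemma deriv_phiN (n : ℕ) :
    deriv (phiN n) = fun β => ∑ p ∈ n.primeFactors,
      Real.log p * cumulant1 (n.factorization p) (Real.log p * β) := by
  funext β
  have h := hasDerivAt_sum_comp_log_mul n (fun _ => 1)
    (f := fun ν t => Real.log (expPowSum ν 0 t) - Real.log ((ν : ℝ) + 1)) (f' := cumulant1)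
    (fun ν t => (hasDerivAt_log_expPowSum ν t).sub_const _) β
  simp only [one_mul] at h
  rw [funext (phiN_eq n)]
  exact h.deriv

lemma iteratedDeriv_two_phiN (n : ℕ) :
    iteratedDeriv 2 (phiN n) = fun β => ∑ p ∈ n.primeFactors,
      Real.log p * Real.log p * cumulant2 (n.factorization p) (Real.log p * β) := by
  rw [iteratedDeriv_succ, iteratedDeriv_one, deriv_phiN]
  funext β
  exact (hasDerivAt_sum_comp_log_mul n (fun p => Real.log p) hasDerivAt_cumulant1 β).deriv

lemma iteratedDeriv_three_phiN (n : ℕ) :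
    iteratedDeriv 3 (phiN n) = fun β => ∑ p ∈ n.primeFactors,
      Real.log p * Real.log p * Real.log p *
        cumulant3 (n.factorization p) (Real.log p * β) := by
  rw [iteratedDeriv_succ, iteratedDeriv_two_phiN]
  funext β
  exact (hasDerivAt_sum_comp_log_mul n (fun p => Real.log p * Real.log p)
    hasDerivAt_cumulant2 β).deriv

lemma log_pos_of_mem_primeFactors {n p : ℕ} (hp : p ∈ n.primeFactors) : 0 < Real.log p :=
  Real.log_pos (by exact_mod_cast (Nat.prime_of_mem_primeFactors hp).one_lt)

lemma factorization_pos_of_mem_primeFactors {n p : ℕ} (hp : p ∈ n.primeFactors) :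
    0 < n.factorization p := by
  rw [← Nat.support_factorization] at hp
  exact Nat.pos_of_ne_zero (Finsupp.mem_support_iff.mp hp)

lemma iteratedDeriv_two_phiN_pos {n : ℕ} (hn : 1 < n) {β : ℝ} (hβ : 0 ≤ β) :
    0 < iteratedDeriv 2 (phiN n) β := by
  rw [iteratedDeriv_two_phiN]
  refine Finset.sum_pos (fun p hp => ?_) (Nat.nonempty_primeFactors.mpr hn)
  have hl := log_pos_of_mem_primeFactors hp
  exact mul_pos (mul_pos hl hl)
    (cumulant2_pos (factorization_pos_of_mem_primeFactors hp) (by positivity))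

lemma iteratedDeriv_two_phiN_zero (n : ℕ) : iteratedDeriv 2 (phiN n) 0 = m2 n := by
  rw [iteratedDeriv_two_phiN, m2, Finset.mul_sum]
  refine Finset.sum_congr rfl fun p _ => ?_
  rw [mul_zero, cumulant2_zero]
  ring

lemma neg_iteratedDeriv_three_phiN_nonneg (n : ℕ) {β : ℝ} (hβ : 0 ≤ β) :
    0 ≤ -iteratedDeriv 3 (phiN n) β := by
  rw [iteratedDeriv_three_phiN, ← Finset.sum_neg_distrib]
  refine Finset.sum_nonneg fun p hp => ?_
  have hl := log_pos_of_mem_primeFactors hp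
  rw [neg_nonneg]
  exact mul_nonpos_of_nonneg_of_nonpos (by positivity) (cumulant3_nonpos _ (by positivity))

lemma neg_iteratedDeriv_three_phiN_le (n : ℕ) {β : ℝ} (hβ : 0 ≤ β) :
    -iteratedDeriv 3 (phiN n) β ≤ 3120 * β * m4 n := by
  rw [iteratedDeriv_three_phiN, ← Finset.sum_neg_distrib, m4, ← mul_assoc, Finset.mul_sum]
  refine Finset.sum_le_sum fun p hp => ?_
  have hl := log_pos_of_mem_primeFactors hp
  have hν : (1 : ℝ) ≤ n.factorization p := by
    exact_mod_cast factorization_pos_of_mem_primeFactors hp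
  have h := neg_cumulant3_le (n.factorization p) (t := Real.log p * β) (by positivity)
  set ν : ℝ := (n.factorization p : ℝ)
  have hpoly : ν ^ 4 ≤ ν * (ν + 2) * (3 * ν ^ 2 + 6 * ν - 4) := by
    have h1 : ν * ν ≤ ν * (ν + 2) := by nlinarith
    have h2 : ν ^ 2 ≤ 3 * ν ^ 2 + 6 * ν - 4 := by nlinarith
    calc ν ^ 4 = ν * ν * ν ^ 2 := by ring
      _ ≤ _ := by gcongr
  calc -(Real.log p * Real.log p * Real.log p *
        cumulant3 (n.factorization p) (Real.log p * β))
      = Real.log p * Real.log p * Real.log p *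
        -cumulant3 (n.factorization p) (Real.log p * β) := by ring
    _ ≤ Real.log p * Real.log p * Real.log p * (13 * ν ^ 4 * (Real.log p * β)) := by gcongr
    _ = 13 * β * Real.log p ^ 4 * ν ^ 4 := by ring
    _ ≤ 13 * β * Real.log p ^ 4 * (ν * (ν + 2) * (3 * ν ^ 2 + 6 * ν - 4)) := by gcongr
    _ = _ := by ring

lemma uQ_pos {x y : ℝ} (hy : 2 ≤ y) (hxy : y ≤ x) : 0 < uQ x y :=
  div_pos (Real.log_pos (by linarith)) (Real.log_pos (by linarith))

lemma ubar_pos {x y : ℝ} (hy : 2 ≤ y) (hxy : y ≤ x) : 0 < ubar x y := by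
  refine lt_min (uQ_pos hy hxy) ?_
  have h : 2 ∈ primesUpTo y := by
    simp only [primesUpTo, Finset.mem_filter, Finset.mem_range]
    exact ⟨Nat.lt_succ_of_le (Nat.le_floor (by exact_mod_cast hy)), Nat.prime_two⟩
  exact_mod_cast Finset.card_pos.mpr ⟨2, h⟩

lemma log_sq_mul_cumulant2_ge {x y : ℝ} (hy : 2 ≤ y) (hxy : y ≤ x) {p ν : ℕ}
    (hp : Real.sqrt y < p) (hpy : (p : ℝ) ≤ y)
    (hν : uQ x y / (2 * ubar x y) ≤ ν) (hν' : (ν : ℝ) ≤ 2 * uQ x y / ubar x y) :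
    Real.exp (-4) / 192 * (Real.log x / ubar x y) ^ 2 ≤
      Real.log p * Real.log p * cumulant2 ν (Real.log p * (ubar x y / Real.log x)) := by
  have hu := uQ_pos hy hxy
  have hub := ubar_pos hy hxy
  have hly : 0 < Real.log y := Real.log_pos (by linarith)
  have hlx : 0 < Real.log x := Real.log_pos (by linarith)
  have hp0 : 0 < (p : ℝ) := (Real.sqrt_nonneg y).trans_lt hp
  have hux : uQ x y * Real.log y = Real.log x := div_mul_cancel₀ _ hly.ne'
  have hlp : Real.log y / 2 ≤ Real.log p := by
    rw [← Real.log_sqrt (by linarith)]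
    exact Real.log_le_log (Real.sqrt_pos.mpr (by linarith)) hp.le
  have hlp' : Real.log p ≤ Real.log y := Real.log_le_log hp0 hpy
  have hlp0 : 0 < Real.log p := by linarith
  set t : ℝ := Real.log p * (ubar x y / Real.log x) with ht
  have hνt : (ν : ℝ) * t ≤ 2 := by
    calc (ν : ℝ) * t
        ≤ (2 * uQ x y / ubar x y) * (Real.log y * (ubar x y / Real.log x)) := by
          rw [ht]; gcongr
      _ = 2 := by rw [← hux]; field_simp
  have hνlog : Real.log x / (4 * ubar x y) ≤ Real.log p * ν := by
    calc Real.log x / (4 * ubar x y)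
        = (Real.log y / 2) * (uQ x y / (2 * ubar x y)) := by rw [← hux]; field_simp; norm_num
      _ ≤ Real.log p * ν := by gcongr
  have hexp : Real.exp (-4) ≤ Real.exp (-(2 * (ν * t))) := Real.exp_le_exp.mpr (by linarith)
  calc Real.exp (-4) / 192 * (Real.log x / ubar x y) ^ 2
      = Real.exp (-4) / 12 * (Real.log x / (4 * ubar x y)) ^ 2 := by field_simp; norm_num
    _ ≤ Real.exp (-(2 * (ν * t))) / 12 * (Real.log p * ν) ^ 2 := by gcongr
    _ ≤ Real.log p * Real.log p * (Real.exp (-(2 * (ν * t))) * (ν * (ν + 2) / 12)) := by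
        have : 0 ≤ Real.log p * Real.log p * Real.exp (-(2 * (ν * t))) * (2 * ν) := by
          positivity
        linarith
    _ ≤ _ := by
        gcongr
        exact cumulant2_ge ν (by positivity)

lemma iteratedDeriv_two_phiN_ge {κ x y : ℝ} (hy : 2 ≤ y) (hxy : y ≤ x) {n : ℕ}
    (hω : κ * ubar x y ≤ (omegaTilde x y n : ℝ)) :
    Real.exp (-4) / 192 * κ * Real.log x ^ 2 / ubar x y ≤
      iteratedDeriv 2 (phiN n) (ubar x y / Real.log x) := by
  have hub := ubar_pos hy hxy
  have hlx : 0 < Real.log x := Real.log_pos (by linarith)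
  rw [iteratedDeriv_two_phiN]
  calc Real.exp (-4) / 192 * κ * Real.log x ^ 2 / ubar x y
      = κ * ubar x y * (Real.exp (-4) / 192 * (Real.log x / ubar x y) ^ 2) := by field_simp
    _ ≤ omegaTilde x y n * (Real.exp (-4) / 192 * (Real.log x / ubar x y) ^ 2) := by gcongr
    _ ≤ _ := by
        rw [omegaTilde, ← nsmul_eq_mul]
        refine (Finset.card_nsmul_le_sum _ _ _ fun p hp => ?_).trans
          (Finset.sum_le_sum_of_subset_of_nonneg (Finset.filter_subset _ _) fun p hp _ => ?_)
        · obtain ⟨-, h1, h2, h3, h4⟩ := Finset.mem_filter.mp hp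
          exact log_sq_mul_cumulant2_ge hy hxy h1 h2 h3 h4
        · have hl := log_pos_of_mem_primeFactors hp
          have := cumulant2_pos (factorization_pos_of_mem_primeFactors hp)
            (t := Real.log p * (ubar x y / Real.log x)) (by positivity)
          positivity

/-- **Lemma 4.1**: properties of `φ_n = log Z_n`. -/
theorem stmt12 :
    (∀ n : ℕ, 1 < n →
      (∀ β : ℝ, 0 ≤ β → 0 < iteratedDeriv 2 (phiN n) β) ∧
        iteratedDeriv 2 (phiN n) 0 = m2 n) ∧
    (∀ κ : ℝ, 0 < κ → ∃ c > (0:ℝ),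
      ∀ x y : ℝ, 2 ≤ y → y ≤ x → ∀ n : ℕ, 1 < n → n ∈ Sf x y →
        κ * ubar x y ≤ (omegaTilde x y n : ℝ) →
        c * Real.log x ^ 2 / ubar x y ≤
          iteratedDeriv 2 (phiN n) (ubar x y / Real.log x)) ∧
    (∃ C > (0:ℝ), ∀ n : ℕ, 1 < n → ∀ β : ℝ, 0 ≤ β →
      0 ≤ -iteratedDeriv 3 (phiN n) β ∧
        -iteratedDeriv 3 (phiN n) β ≤ C * β * m4 n) := by
  refine ⟨fun n hn => ⟨fun β hβ => iteratedDeriv_two_phiN_pos hn hβ,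
    iteratedDeriv_two_phiN_zero n⟩, fun κ hκ => ⟨Real.exp (-4) / 192 * κ, by positivity,
    fun x y hy hxy n _ _ hω => iteratedDeriv_two_phiN_ge hy hxy hω⟩,
    3120, by norm_num, fun n _ β hβ => ⟨neg_iteratedDeriv_three_phiN_nonneg n hβ,
    neg_iteratedDeriv_three_phiN_le n hβ⟩⟩

end
end

section
/- For all κ₁ > 0 and κ₂ ∈ (0,1) there exist constants c > 0 and C > 0 (depending only on κ₁, κ₂) such that for all real x ≥ y ≥ 2 and every integer n ∈ S(x,y) satisfying n ≥ √x, ω̃_{x,y}(n) ≥ κ₁·ū, κ₂ ≤ m_{2,n}·ū/(log x)² ≤ 1/κ₂ and κ₂/ū ≤ m_{4,n}·ū³/(log x)⁴ ≤ 1/κ₂, one has, for all z with 0 ≤ z ≤ c·√ū: C^{−1}·√ū/log x ≤ β_n'(z) ≤ C·√ū/log x, and consequently C^{−1}·z·√ū/log x ≤ β_n(z) ≤ C·z·√ū/log x. -/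
open Finset MeasureTheory
open scoped Classical

noncomputable section

/-- The `k`-th unnormalised moment of the exponentially tilted uniform law on `{0, …, ν}`. -/
def tiltedMoment (ν k : ℕ) (t : ℝ) : ℝ :=
  ∑ j ∈ Finset.range (ν + 1), (j : ℝ) ^ k * Real.exp (j * t)

/-- The mean of the exponentially tilted uniform law on `{0, …, ν}`. -/
def tiltedMean (ν : ℕ) (t : ℝ) : ℝ := tiltedMoment ν 1 t / tiltedMoment ν 0 t

/-- The variance of the exponentially tilted uniform law on `{0, …, ν}`. -/
def tiltedVar (ν : ℕ) (t : ℝ) : ℝ :=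
  (tiltedMoment ν 2 t * tiltedMoment ν 0 t - tiltedMoment ν 1 t ^ 2) / tiltedMoment ν 0 t ^ 2

lemma tiltedMoment_zero_pos (ν : ℕ) (t : ℝ) : 0 < tiltedMoment ν 0 t :=
  Finset.sum_pos (fun j _ => by positivity) ⟨0, by simp⟩

lemma hasDerivAt_tiltedMoment (ν k : ℕ) (t : ℝ) :
    HasDerivAt (tiltedMoment ν k) (tiltedMoment ν (k + 1) t) t := by
  unfold tiltedMoment
  refine HasDerivAt.fun_sum fun j _ => ?_
  have h := (((hasDerivAt_id t).const_mul (j : ℝ)).exp).const_mul ((j : ℝ) ^ k)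
  refine h.congr_deriv ?_
  simp only [id, mul_one]
  ring

lemma hasDerivAt_tiltedMean (ν : ℕ) (t : ℝ) :
    HasDerivAt (tiltedMean ν) (tiltedVar ν t) t := by
  refine ((hasDerivAt_tiltedMoment ν 1 t).div (hasDerivAt_tiltedMoment ν 0 t)
    (tiltedMoment_zero_pos ν t).ne').congr_deriv ?_
  unfold tiltedVar
  ring

lemma two_mul_tiltedMoment_sub (ν : ℕ) (t : ℝ) :
    2 * (tiltedMoment ν 2 t * tiltedMoment ν 0 t - tiltedMoment ν 1 t ^ 2) =
      ∑ j ∈ Finset.range (ν + 1), ∑ k ∈ Finset.range (ν + 1),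
        ((j : ℝ) - k) ^ 2 * (Real.exp (j * t) * Real.exp (k * t)) := by
  have e : ∀ j k : ℕ, ((j : ℝ) - k) ^ 2 * (Real.exp (j * t) * Real.exp (k * t)) =
      ((j : ℝ) ^ 2 * Real.exp (j * t)) * ((k : ℝ) ^ 0 * Real.exp (k * t)) +
      ((j : ℝ) ^ 0 * Real.exp (j * t)) * ((k : ℝ) ^ 2 * Real.exp (k * t)) -
      2 * (((j : ℝ) ^ 1 * Real.exp (j * t)) * ((k : ℝ) ^ 1 * Real.exp (k * t))) := by
    intro j k
    ring
  simp_rw [e, Finset.sum_sub_distrib, Finset.sum_add_distrib, ← Finset.mul_sum,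
    ← Finset.sum_mul]
  unfold tiltedMoment
  ring

lemma tiltedVar_nonneg (ν : ℕ) (t : ℝ) : 0 ≤ tiltedVar ν t := by
  refine div_nonneg ?_ (sq_nonneg _)
  have h := two_mul_tiltedMoment_sub ν t
  have : 0 ≤ ∑ j ∈ Finset.range (ν + 1), ∑ k ∈ Finset.range (ν + 1),
      ((j : ℝ) - k) ^ 2 * (Real.exp (j * t) * Real.exp (k * t)) := by positivity
  linarith

lemma tiltedVar_le (ν : ℕ) (t : ℝ) : tiltedVar ν t ≤ (ν : ℝ) * (ν + 2) := by
  have h0 := tiltedMoment_zero_pos ν t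
  have h2 : tiltedMoment ν 2 t ≤ (ν : ℝ) ^ 2 * tiltedMoment ν 0 t := by
    unfold tiltedMoment
    rw [Finset.mul_sum]
    refine Finset.sum_le_sum fun j hj => ?_
    have : (j : ℝ) ≤ ν := by
      exact_mod_cast Nat.lt_succ_iff.mp (Finset.mem_range.mp hj)
    rw [pow_zero, one_mul]
    gcongr
  unfold tiltedVar
  rw [div_le_iff₀ (by positivity)]
  have hν : (0 : ℝ) ≤ ν := by positivity
  nlinarith [mul_le_mul_of_nonneg_right h2 h0.le, sq_nonneg (tiltedMoment ν 1 t),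
    mul_nonneg hν (sq_nonneg (tiltedMoment ν 0 t))]

lemma tiltedMoment_zero_at_zero (ν : ℕ) : tiltedMoment ν 0 0 = ν + 1 := by
  simp [tiltedMoment]

lemma tiltedMoment_one_at_zero (ν : ℕ) : tiltedMoment ν 1 0 = (ν : ℝ) * (ν + 1) / 2 := by
  induction ν with
  | zero => simp [tiltedMoment]
  | succ m ih =>
    have h : tiltedMoment (m + 1) 1 0 = tiltedMoment m 1 0 + (m + 1 : ℝ) := by
      simp [tiltedMoment, Finset.sum_range_succ _ (m + 1)]
    rw [h, ih]
    push_cast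
    ring

lemma tiltedMoment_two_at_zero (ν : ℕ) :
    tiltedMoment ν 2 0 = (ν : ℝ) * (ν + 1) * (2 * ν + 1) / 6 := by
  induction ν with
  | zero => simp [tiltedMoment]
  | succ m ih =>
    have h : tiltedMoment (m + 1) 2 0 = tiltedMoment m 2 0 + (m + 1 : ℝ) ^ 2 := by
      simp [tiltedMoment, Finset.sum_range_succ _ (m + 1)]
    rw [h, ih]
    push_cast
    ring

lemma tiltedMean_zero (ν : ℕ) : tiltedMean ν 0 = ν / 2 := by
  have h : (ν : ℝ) + 1 ≠ 0 := by positivity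
  rw [tiltedMean, tiltedMoment_one_at_zero, tiltedMoment_zero_at_zero]
  field_simp

lemma le_tiltedVar (ν : ℕ) {t a : ℝ} (ht : 0 ≤ t) (ha : ν * t ≤ a) :
    Real.exp (-(2 * a)) * ((ν : ℝ) * (ν + 2) / 12) ≤ tiltedVar ν t := by
  have h0 := tiltedMoment_zero_pos ν t
  have hS0 : tiltedMoment ν 0 t ≤ (ν + 1) * Real.exp a := by
    have : tiltedMoment ν 0 t ≤ ∑ j ∈ Finset.range (ν + 1), Real.exp a := by
      unfold tiltedMoment
      refine Finset.sum_le_sum fun j hj => ?_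
      have : (j : ℝ) ≤ ν := by
        exact_mod_cast Nat.lt_succ_iff.mp (Finset.mem_range.mp hj)
      rw [pow_zero, one_mul]
      exact Real.exp_le_exp.mpr ((mul_le_mul_of_nonneg_right this ht).trans ha)
    simpa using this
  have hnum : ((ν : ℝ) + 1) ^ 2 * ((ν : ℝ) * (ν + 2) / 12) ≤
      tiltedMoment ν 2 t * tiltedMoment ν 0 t - tiltedMoment ν 1 t ^ 2 := by
    have h1 := two_mul_tiltedMoment_sub ν t
    have h2 := two_mul_tiltedMoment_sub ν 0
    rw [tiltedMoment_zero_at_zero, tiltedMoment_one_at_zero, tiltedMoment_two_at_zero] at h2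
    have h3 : ∑ j ∈ Finset.range (ν + 1), ∑ k ∈ Finset.range (ν + 1),
        ((j : ℝ) - k) ^ 2 * (Real.exp (j * 0) * Real.exp (k * 0)) ≤
        ∑ j ∈ Finset.range (ν + 1), ∑ k ∈ Finset.range (ν + 1),
        ((j : ℝ) - k) ^ 2 * (Real.exp (j * t) * Real.exp (k * t)) := by
      gcongr
    nlinarith
  unfold tiltedVar
  rw [le_div_iff₀ (by positivity)]
  refine le_trans ?_ hnum
  have h4 : tiltedMoment ν 0 t ^ 2 ≤ ((ν + 1) * Real.exp a) ^ 2 := by gcongr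
  have h5 : Real.exp (-(2 * a)) * Real.exp a ^ 2 = 1 := by
    rw [← Real.exp_nat_mul, ← Real.exp_add]
    simp
  calc Real.exp (-(2 * a)) * ((ν : ℝ) * (ν + 2) / 12) * tiltedMoment ν 0 t ^ 2
      ≤ Real.exp (-(2 * a)) * ((ν : ℝ) * (ν + 2) / 12) * ((ν + 1) * Real.exp a) ^ 2 := by gcongr
    _ = (Real.exp (-(2 * a)) * Real.exp a ^ 2) *
        (((ν : ℝ) + 1) ^ 2 * ((ν : ℝ) * (ν + 2) / 12)) := by ring
    _ = _ := by rw [h5, one_mul]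

/-- The first derivative of `phiN n`. -/
def phiDeriv (n : ℕ) (β : ℝ) : ℝ :=
  ∑ p ∈ n.primeFactors, Real.log p * tiltedMean (n.factorization p) (Real.log p * β)

/-- The second derivative of `phiN n`. -/
def phiDeriv₂ (n : ℕ) (β : ℝ) : ℝ :=
  ∑ p ∈ n.primeFactors, Real.log p ^ 2 * tiltedVar (n.factorization p) (Real.log p * β)

lemma phiN_eq_sum (n : ℕ) (β : ℝ) :
    phiN n β = ∑ p ∈ n.primeFactors,
      Real.log (tiltedMoment (n.factorization p) 0 (Real.log p * β) /
        ((n.factorization p : ℝ) + 1)) := by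
  unfold phiN ZnR
  have e : ∀ p ∈ n.primeFactors,
      ∑ j ∈ Finset.range (n.factorization p + 1), (p : ℝ) ^ ((j : ℝ) * β) =
        tiltedMoment (n.factorization p) 0 (Real.log p * β) := by
    intro p hp
    have hp0 : (0 : ℝ) < p := by exact_mod_cast (Nat.prime_of_mem_primeFactors hp).pos
    refine Finset.sum_congr rfl fun j _ => ?_
    rw [Real.rpow_def_of_pos hp0, pow_zero, one_mul]
    ring_nf
  rw [Real.log_prod]
  · exact Finset.sum_congr rfl fun p hp => by rw [e p hp]
  · intro p hp
    rw [e p hp]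
    have := tiltedMoment_zero_pos (n.factorization p) (Real.log p * β)
    positivity

lemma hasDerivAt_phiN (n : ℕ) (β : ℝ) : HasDerivAt (phiN n) (phiDeriv n β) β := by
  rw [funext (phiN_eq_sum n)]
  refine HasDerivAt.fun_sum fun p _ => ?_
  have h0 := tiltedMoment_zero_pos (n.factorization p) (Real.log p * β)
  have h1 := (hasDerivAt_tiltedMoment (n.factorization p) 0 (Real.log p * β)).comp β
    ((hasDerivAt_id β).const_mul (Real.log p))
  have h2 := (h1.div_const ((n.factorization p : ℝ) + 1)).log
    (div_pos h0 (by positivity : (0 : ℝ) < n.factorization p + 1)).ne'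
  refine h2.congr_deriv ?_
  have : (n.factorization p : ℝ) + 1 ≠ 0 := by positivity
  simp only [Function.comp, tiltedMean]
  field_simp

lemma hasDerivAt_phiDeriv (n : ℕ) (β : ℝ) : HasDerivAt (phiDeriv n) (phiDeriv₂ n β) β := by
  unfold phiDeriv
  refine HasDerivAt.fun_sum fun p _ => ?_
  have h1 := ((hasDerivAt_tiltedMean (n.factorization p) (Real.log p * β)).comp β
    ((hasDerivAt_id β).const_mul (Real.log p))).const_mul (Real.log p)
  refine h1.congr_deriv ?_
  ring

lemma phiDeriv_zero (n : ℕ) : phiDeriv n 0 = (1 / 2) * Real.log n := by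
  rw [Real.log_nat_eq_sum_factorization, Finsupp.sum, Nat.support_factorization,
    Finset.mul_sum]
  refine Finset.sum_congr rfl fun p _ => ?_
  rw [mul_zero, tiltedMean_zero]
  ring

lemma phiDeriv₂_nonneg (n : ℕ) (β : ℝ) : 0 ≤ phiDeriv₂ n β :=
  Finset.sum_nonneg fun _ _ => mul_nonneg (sq_nonneg _) (tiltedVar_nonneg _ _)

lemma phiDeriv₂_le (n : ℕ) (β : ℝ) : phiDeriv₂ n β ≤ 12 * m2 n := by
  unfold phiDeriv₂ m2
  rw [← mul_assoc, show (12 : ℝ) * (1 / 12) = 1 by norm_num, one_mul]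
  refine Finset.sum_le_sum fun p _ => ?_
  rw [mul_comm]
  exact mul_le_mul_of_nonneg_right (tiltedVar_le _ _) (sq_nonneg _)

lemma one_le_ubar {x y : ℝ} (hy : 2 ≤ y) (hxy : y ≤ x) : 1 ≤ ubar x y := by
  have hly : 0 < Real.log y := Real.log_pos (by linarith)
  refine le_min ?_ ?_
  · rw [uQ, one_le_div hly]
    exact Real.log_le_log (by linarith) hxy
  · have h2 : 2 ∈ primesUpTo y := by
      refine Finset.mem_filter.mpr ⟨Finset.mem_range.mpr ?_, Nat.prime_two⟩
      exact Nat.lt_succ_iff.mpr (Nat.le_floor (by exact_mod_cast hy))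
    exact_mod_cast Finset.card_pos.mpr ⟨2, h2⟩

lemma le_phiDeriv₂ {x y κ β : ℝ} {n : ℕ} (hy : 2 ≤ y) (hxy : y ≤ x)
    (hω : κ * ubar x y ≤ (omegaTilde x y n : ℝ)) (hβ : 0 ≤ β)
    (hβ' : β ≤ ubar x y / Real.log x) :
    Real.exp (-4) * κ / 192 * (Real.log x ^ 2 / ubar x y) ≤ phiDeriv₂ n β := by
  have hu := one_le_ubar hy hxy
  have hu0 : 0 < ubar x y := by linarith
  have hly : 0 < Real.log y := Real.log_pos (by linarith)
  have hlx : 0 < Real.log x := Real.log_pos (by linarith)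
  have huQ : 0 ≤ uQ x y := by unfold uQ; positivity
  set s := (n.primeFactors).filter fun p : ℕ =>
    Real.sqrt y < (p : ℝ) ∧ (p : ℝ) ≤ y ∧
      uQ x y / (2 * ubar x y) ≤ (n.factorization p : ℝ) ∧
      (n.factorization p : ℝ) ≤ 2 * uQ x y / ubar x y with hs
  have hcard : (omegaTilde x y n : ℝ) = s.card := rfl
  set q : ℝ := Real.exp (-4) / 192 * (Real.log x ^ 2 / ubar x y ^ 2) with hq
  have hterm : ∀ p ∈ s,
      q ≤ Real.log p ^ 2 * tiltedVar (n.factorization p) (Real.log p * β) := by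
    intro p hp
    obtain ⟨-, h1, h2, h3, h4⟩ := Finset.mem_filter.mp hp
    have hp0 : (0 : ℝ) < p := (Real.sqrt_nonneg y).trans_lt h1
    have hL1 : Real.log y / 2 ≤ Real.log p := by
      rw [← Real.log_sqrt (by linarith)]
      exact Real.log_le_log (Real.sqrt_pos.mpr (by linarith)) h1.le
    have hL2 : Real.log p ≤ Real.log y := Real.log_le_log hp0 h2
    have hL0 : 0 ≤ Real.log p := by linarith
    set ν : ℝ := (n.factorization p : ℝ) with hν
    have hν0 : 0 ≤ ν := by positivity
    have hνt : ν * (Real.log p * β) ≤ 2 := by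
      calc ν * (Real.log p * β)
          ≤ (2 * uQ x y / ubar x y) * (Real.log y * (ubar x y / Real.log x)) := by gcongr
        _ = 2 := by
          unfold uQ
          field_simp
    have hv := le_tiltedVar (n.factorization p) (mul_nonneg hL0 hβ) hνt
    have hprod : Real.log x / (4 * ubar x y) ≤ Real.log p * ν := by
      calc Real.log x / (4 * ubar x y)
          = Real.log y / 2 * (uQ x y / (2 * ubar x y)) := by
            unfold uQ
            field_simp
            norm_num
        _ ≤ Real.log p * ν := by
          gcongr
    calc q = Real.exp (-4) / 12 * (Real.log x / (4 * ubar x y)) ^ 2 := by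
          rw [hq]
          field_simp
          norm_num
      _ ≤ Real.exp (-4) / 12 * (Real.log p * ν) ^ 2 := by gcongr
      _ = Real.log p ^ 2 * (Real.exp (-4) * (ν * ν / 12)) := by ring
      _ ≤ Real.log p ^ 2 * (Real.exp (-4) * (ν * (ν + 2) / 12)) := by
          gcongr
          linarith
      _ ≤ _ := by
          refine mul_le_mul_of_nonneg_left ?_ (sq_nonneg _)
          norm_num at hv
          linarith
  calc Real.exp (-4) * κ / 192 * (Real.log x ^ 2 / ubar x y) = (κ * ubar x y) * q := by
        rw [hq]
        field_simp
    _ ≤ s.card * q := by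
        rw [← hcard]
        gcongr
    _ ≤ ∑ p ∈ s, Real.log p ^ 2 * tiltedVar (n.factorization p) (Real.log p * β) := by
        rw [← nsmul_eq_mul]
        exact Finset.card_nsmul_le_sum _ _ _ hterm
    _ ≤ phiDeriv₂ n β :=
        Finset.sum_le_sum_of_subset_of_nonneg (Finset.filter_subset _ _)
          fun _ _ _ => mul_nonneg (sq_nonneg _) (tiltedVar_nonneg _ _)

/-- A right inverse of an increasing function, with the argument rescaled by `σ`, whose values are
controlled by lower and upper bounds for the derivative. -/
lemma rightInverse_bounds {A B g : ℝ → ℝ} {σ T b R M z₀ z : ℝ}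
    (hA : ∀ β, HasDerivAt A (B β) β) (hB0 : ∀ β, 0 ≤ B β) (hBM : ∀ β, B β ≤ M)
    (hBb : ∀ β, 0 ≤ β → β ≤ R → b ≤ B β) (hb : 0 < b) (hR : 0 ≤ R) (hσ : 0 < σ)
    (hg : ∀ w ∈ Set.Ico 0 T, 0 ≤ g w ∧ A (g w) = A 0 + w * σ)
    (hz : 0 ≤ z) (hzz : z < z₀) (hzT : z₀ < T) (hzR : z₀ * σ < b * R) :
    (0 ≤ g z ∧ g z ≤ R) ∧ HasDerivWithinAt g (σ / B (g z)) (Set.Ico 0 T) z ∧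
      b * g z ≤ z * σ ∧ z * σ ≤ M * g z := by
  have hdiff : Differentiable ℝ A := fun β => (hA β).differentiableAt
  have hder : ∀ β, deriv A β = B β := fun β => (hA β).deriv
  have hmono : Monotone A := monotone_of_deriv_nonneg hdiff fun β => by rw [hder]; exact hB0 β
  have hlow : ∀ s t, 0 ≤ s → s ≤ t → t ≤ R → b * (t - s) ≤ A t - A s := by
    intro s t hs hst ht
    refine Convex.mul_sub_le_image_sub_of_le_deriv (convex_Icc 0 R) hdiff.continuous.continuousOn
      hdiff.differentiableOn ?_ s ⟨hs, hst.trans ht⟩ t ⟨hs.trans hst, ht⟩ hst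
    intro β hβ
    have hβ' := interior_subset hβ
    rw [hder]
    exact hBb β hβ'.1 hβ'.2
  have hmem : ∀ w, 0 ≤ w → w < z₀ → 0 ≤ g w ∧ g w ≤ R := by
    intro w hw hwz
    obtain ⟨h0, h1⟩ := hg w ⟨hw, hwz.trans hzT⟩
    refine ⟨h0, ?_⟩
    by_contra! hlt
    have h2 := hmono hlt.le
    have h3 := hlow 0 R le_rfl hR le_rfl
    nlinarith
  have hLip : ∀ v w, 0 ≤ v → v < z₀ → 0 ≤ w → w < z₀ → |g v - g w| ≤ σ / b * |v - w| := by
    have key : ∀ v w, 0 ≤ v → v < z₀ → 0 ≤ w → w < z₀ → g w ≤ g v →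
        |g v - g w| ≤ σ / b * |v - w| := by
      intro v w hv hv' hw hw' hle
      have h1 := hlow (g w) (g v) (hmem w hw hw').1 hle (hmem v hv hv').2
      rw [(hg v ⟨hv, hv'.trans hzT⟩).2, (hg w ⟨hw, hw'.trans hzT⟩).2] at h1
      rw [abs_of_nonneg (sub_nonneg.mpr hle), div_mul_eq_mul_div, le_div_iff₀ hb]
      nlinarith [le_abs_self (v - w)]
    intro v w hv hv' hw hw'
    rcases le_total (g w) (g v) with h | h
    · exact key v w hv hv' hw hw' h
    · rw [abs_sub_comm (g v), abs_sub_comm v]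
      exact key w v hw hw' hv hv' h
  have hmz := hmem z hz hzz
  have hzmem : z ∈ Set.Ico 0 T := ⟨hz, hzz.trans hzT⟩
  have hAz := (hg z hzmem).2
  have hBpos : 0 < B (g z) := hb.trans_le (hBb _ hmz.1 hmz.2)
  refine ⟨hmz, ?_, ?_, ?_⟩
  · have hcont : ContinuousWithinAt g (Set.Ico 0 T) z := by
      rw [ContinuousWithinAt, tendsto_iff_dist_tendsto_zero]
      have hlim : Filter.Tendsto (fun v => σ / b * |v - z|) (nhdsWithin z (Set.Ico 0 T))
          (nhds 0) := by
        have : Continuous fun v : ℝ => σ / b * |v - z| := by fun_prop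
        simpa using (this.tendsto z).mono_left nhdsWithin_le_nhds
      refine squeeze_zero' (Filter.Eventually.of_forall fun _ => dist_nonneg) ?_ hlim
      filter_upwards [self_mem_nhdsWithin, mem_nhdsWithin_of_mem_nhds (Iio_mem_nhds hzz)]
        with v hv hv'
      exact hLip v z hv.1 hv' hz hzz
    have hf : HasDerivAt (fun β => (A β - A 0) / σ) (B (g z) / σ) (g z) :=
      ((hA (g z)).sub_const (A 0)).div_const σ
    have hne : B (g z) / σ ≠ 0 := (div_pos hBpos hσ).ne'
    have h := HasFDerivWithinAt.of_local_left_inverse (t := Set.univ) (g := g)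
      (by rw [nhdsWithin_univ]; exact hcont) (hf.hasFDerivAt_equiv hne).hasFDerivWithinAt hzmem
      (by
        filter_upwards [self_mem_nhdsWithin] with v hv
        rw [(hg v hv).2]
        field_simp
        ring)
    refine h.hasDerivWithinAt.congr_deriv ?_
    simp
  · have := hlow 0 (g z) le_rfl hmz.1 hmz.2
    nlinarith
  · have := Convex.image_sub_le_mul_sub_of_deriv_le convex_univ hdiff.continuous.continuousOn
      hdiff.differentiableOn (C := M) (fun β _ => by rw [hder]; exact hBM β)
      0 (Set.mem_univ _) (g z) (Set.mem_univ _) hmz.1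
    nlinarith

/-- Explicit form of `rightInverse_bounds` when the derivative has order of magnitude `X ^ 2 / r ^ 2`
on the interval `[0, r ^ 2 / X]`. -/
lemma rightInverse_order_of_magnitude {A B g : ℝ → ℝ} {k a r X σ T z : ℝ}
    (hk0 : 0 < k) (ha0 : 0 < a) (hr0 : 0 < r) (hX : 0 < X) (hσ0 : 0 < σ)
    (hσr : σ * r * k ≤ X) (hT : k * r / 4 ≤ T)
    (hA : ∀ β, HasDerivAt A (B β) β) (hBn : ∀ β, 0 ≤ B β) (hBM : ∀ β, B β ≤ 12 * σ ^ 2)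
    (hBb : ∀ β, 0 ≤ β → β ≤ r ^ 2 / X → a * (X ^ 2 / r ^ 2) ≤ B β)
    (hg : ∀ w ∈ Set.Ico 0 T, 0 ≤ g w ∧ A (g w) = A 0 + w * σ)
    (hz : 0 ≤ z) (hzc : z ≤ k * min a (1 / 4) / 4 * r) :
    (((12 + 1 / a) / k)⁻¹ * r / X ≤ derivWithin g (Set.Ico 0 T) z ∧
      derivWithin g (Set.Ico 0 T) z ≤ (12 + 1 / a) / k * r / X) ∧
    (((12 + 1 / a) / k)⁻¹ * z * r / X ≤ g z ∧ g z ≤ (12 + 1 / a) / k * z * r / X) := by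
  have hmin0 : 0 < min a (1 / 4) := lt_min ha0 (by norm_num)
  have hmina : min a (1 / 4) ≤ a := min_le_left _ _
  have hmin4 : min a (1 / 4) ≤ 1 / 4 := min_le_right _ _
  have ha1 : 0 < 1 / a := by positivity
  have hCinv : ((12 + 1 / a) / k)⁻¹ ≤ k / 12 := by
    rw [inv_div]
    gcongr
    linarith
  have hCa : 1 / (a * k) ≤ (12 + 1 / a) / k := by
    rw [← div_div]
    gcongr
    linarith
  generalize (12 + 1 / a) / k = C at hCinv hCa ⊢
  generalize min a (1 / 4) = d at hmin0 hmina hmin4 hzc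
  have hkr : 0 < k * r := by positivity
  have hdkr : 0 < d * (k * r) := by positivity
  have hz₀T : k * d / 2 * r < T := by
    refine lt_of_lt_of_le ?_ hT
    nlinarith
  have hz₀R : k * d / 2 * r * σ < a * (X ^ 2 / r ^ 2) * (r ^ 2 / X) := by
    have e : a * (X ^ 2 / r ^ 2) * (r ^ 2 / X) = a * X := by field_simp
    rw [e]
    have h1 : d * (σ * r * k) ≤ a * X := by gcongr
    have h2 : 0 < d * (σ * r * k) := by positivity
    linarith
  have hzz : z < k * d / 2 * r := by linarith
  obtain ⟨⟨hβ0, hβR⟩, hd, hlo, hhi⟩ := rightInverse_bounds hA hBn hBM hBb (by positivity)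
    (by positivity) hσ0 hg hz hzz hz₀T hz₀R
  rw [hd.derivWithin (uniqueDiffOn_Ico _ _ z ⟨hz, hzz.trans hz₀T⟩)]
  have hb0 : 0 < a * (X ^ 2 / r ^ 2) := by positivity
  have hB0 := hb0.trans_le (hBb _ hβ0 hβR)
  have hlow : C⁻¹ * r / X ≤ σ / (12 * σ ^ 2) := by
    calc C⁻¹ * r / X ≤ k / 12 * r / X := by gcongr
      _ ≤ σ / (12 * σ ^ 2) := by
        rw [div_le_div_iff₀ hX (by positivity)]
        nlinarith
  have hupp : σ / (a * (X ^ 2 / r ^ 2)) ≤ C * r / X := by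
    refine le_trans ?_ (show 1 / (a * k) * r / X ≤ C * r / X by gcongr)
    have e : σ / (a * (X ^ 2 / r ^ 2)) = r * (σ * r * k) / (a * k * X ^ 2) := by field_simp
    have e' : 1 / (a * k) * r / X = r * X / (a * k * X ^ 2) := by field_simp
    rw [e, e']
    gcongr
  refine ⟨⟨hlow.trans ?_, le_trans ?_ hupp⟩, ?_, ?_⟩
  · exact div_le_div_of_nonneg_left hσ0.le hB0 (hBM _)
  · exact div_le_div_of_nonneg_left hσ0.le hb0 (hBb _ hβ0 hβR)
  · calc C⁻¹ * z * r / X = z * (C⁻¹ * r / X) := by ring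
      _ ≤ z * (σ / (12 * σ ^ 2)) := by gcongr
      _ = z * σ / (12 * σ ^ 2) := by ring
      _ ≤ g z := by
        rw [div_le_iff₀ (by positivity)]
        linarith
  · calc g z ≤ z * σ / (a * (X ^ 2 / r ^ 2)) := by
          rw [le_div_iff₀ hb0]
          linarith
      _ = z * (σ / (a * (X ^ 2 / r ^ 2))) := by ring
      _ ≤ z * (C * r / X) := by gcongr
      _ = C * z * r / X := by ring

/-- **Lemma 4.3**: order of magnitude of `β_n(z)` and `β_n'(z)`. -/
theorem stmt14 :
    ∀ κ₁ κ₂ : ℝ, 0 < κ₁ → 0 < κ₂ → κ₂ < 1 →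
      ∃ c > (0:ℝ), ∃ C > (0:ℝ),
        ∀ x y : ℝ, 2 ≤ y → y ≤ x → ∀ n : ℕ, n ∈ Sf x y → Real.sqrt x ≤ (n : ℝ) →
          κ₁ * ubar x y ≤ (omegaTilde x y n : ℝ) →
          κ₂ ≤ m2 n * ubar x y / Real.log x ^ 2 →
          m2 n * ubar x y / Real.log x ^ 2 ≤ 1 / κ₂ →
          κ₂ / ubar x y ≤ m4 n * ubar x y ^ 3 / Real.log x ^ 4 →
          m4 n * ubar x y ^ 3 / Real.log x ^ 4 ≤ 1 / κ₂ →
          ∀ βf : ℝ → ℝ,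
            (∀ z ∈ Set.Ico (0:ℝ) (Real.log n / (2 * sigman n)),
              0 ≤ βf z ∧
                deriv (phiN n) (βf z) = (1/2) * Real.log n + z * sigman n) →
            ∀ z : ℝ, 0 ≤ z → z ≤ c * Real.sqrt (ubar x y) →
              (C⁻¹ * Real.sqrt (ubar x y) / Real.log x ≤
                  derivWithin βf (Set.Ico 0 (Real.log n / (2 * sigman n))) z ∧
                derivWithin βf (Set.Ico 0 (Real.log n / (2 * sigman n))) z ≤
                  C * Real.sqrt (ubar x y) / Real.log x) ∧
              (C⁻¹ * z * Real.sqrt (ubar x y) / Real.log x ≤ βf z ∧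
                βf z ≤ C * z * Real.sqrt (ubar x y) / Real.log x) := by
  intro κ₁ κ₂ hκ₁ hκ₂ _
  have hk0 : 0 < Real.sqrt κ₂ := Real.sqrt_pos.mpr hκ₂
  have ha0 : 0 < Real.exp (-4) * κ₁ / 192 := by positivity
  refine ⟨Real.sqrt κ₂ * min (Real.exp (-4) * κ₁ / 192) (1 / 4) / 4,
    div_pos (mul_pos hk0 (lt_min ha0 (by norm_num))) (by norm_num),
    (12 + 1 / (Real.exp (-4) * κ₁ / 192)) / Real.sqrt κ₂, by positivity, ?_⟩
  intro x y hy hxy n _ hxn hω hm1 hm2 _ _ βf hβf z hz hzc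
  have hU0 : 0 < ubar x y := one_pos.trans_le (one_le_ubar hy hxy)
  have hX : 0 < Real.log x := Real.log_pos (by linarith)
  have hlogn : Real.log x / 2 ≤ Real.log n := by
    rw [← Real.log_sqrt (by linarith)]
    exact Real.log_le_log (Real.sqrt_pos.mpr (by linarith)) hxn
  have hr0 : 0 < Real.sqrt (ubar x y) := Real.sqrt_pos.mpr hU0
  have hr2 : Real.sqrt (ubar x y) ^ 2 = ubar x y := Real.sq_sqrt hU0.le
  rw [le_div_iff₀ (by positivity)] at hm1
  rw [div_le_div_iff₀ (by positivity) hκ₂, one_mul] at hm2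
  have hm0 : 0 < m2 n := by
    have : 0 < m2 n * ubar x y := lt_of_lt_of_le (by positivity) hm1
    exact (pos_iff_pos_of_mul_pos this).mpr hU0
  have hσ0 : 0 < sigman n := Real.sqrt_pos.mpr hm0
  have hσ2 : sigman n ^ 2 = m2 n := Real.sq_sqrt hm0.le
  have hσr : sigman n * Real.sqrt (ubar x y) * Real.sqrt κ₂ ≤ Real.log x := by
    refine le_of_sq_le_sq ?_ hX.le
    rw [mul_pow, mul_pow, hσ2, hr2, Real.sq_sqrt hκ₂.le]
    exact hm2
  have hT : Real.sqrt κ₂ * Real.sqrt (ubar x y) / 4 ≤ Real.log n / (2 * sigman n) := by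
    rw [le_div_iff₀ (by positivity)]
    linarith
  refine rightInverse_order_of_magnitude hk0 ha0 hr0 hX hσ0 hσr hT (hasDerivAt_phiDeriv n)
    (phiDeriv₂_nonneg n) (fun β => by rw [hσ2]; exact phiDeriv₂_le n β)
    (fun β h h' => ?_) (fun w hw => ⟨(hβf w hw).1, ?_⟩) hz hzc
  · rw [hr2] at h' ⊢
    exact le_phiDeriv₂ hy hxy hω h h'
  · rw [phiDeriv_zero, ← (hβf w hw).2, (hasDerivAt_phiN n _).deriv]

end
end
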